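/- Let d, N ≥ 1 be integers, let a ∈ ℝ^d be a point with all coordinates in [0, N], and let b, T > 0 be real parameters. Then the proportion of vertices v ∈ V for which |dist_d(a, v)² − B_{a,V}| ≥ 1/(bT) is at most b² T² / (4d). -/

import Mathlib

/-- Euclidean distance between two points of `ℝ^d`. -/
noncomputable def dE {d : ℕ} (x y : Fin d → ℝ) : ℝ :=
  Real.sqrt (∑ i, (x i - y i) ^ 2)

/-- Normalized distance `dist(x,y)/(√d · N)`. -/
noncomputable def dn (d N : ℕ) (x y : Fin d → ℝ) : ℝ :=
  dE x y / (Real.sqrt d * N)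

/-- The lattice points `{0,1,…,N}^d` of the hypercube `[0,N]^d`. -/
noncomputable def cubeW (d N : ℕ) : Finset (Fin d → ℝ) :=
  Finset.image (fun f : Fin d → Fin (N + 1) => fun i => (f i : ℝ)) Finset.univ

/-- The `2^d` vertices `{0,N}^d` of the hypercube `[0,N]^d`. -/
noncomputable def cubeV (d N : ℕ) : Finset (Fin d → ℝ) :=
  Finset.image (fun f : Fin d → Bool => fun i => if f i then (N : ℝ) else 0) Finset.univ

/-- The center `(N/2, …, N/2)` of the hypercube `[0,N]^d`. -/
noncomputable def ctr (d N : ℕ) : Fin d → ℝ := fun _ => (N : ℝ) / 2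

/-- Average of squared Euclidean distances from `a` to the vertices. -/
noncomputable def A_V (d N : ℕ) (a : Fin d → ℝ) : ℝ :=
  (∑ v ∈ cubeV d N, dE v a ^ 2) / 2 ^ d

/-- Normalized average of squared distances from `a` to the vertices. -/
noncomputable def B_V (d N : ℕ) (a : Fin d → ℝ) : ℝ :=
  A_V d N a / (d * (N : ℝ) ^ 2)

/-- Average of squared Euclidean distances from `a` to the lattice points. -/
noncomputable def A_W (d N : ℕ) (a : Fin d → ℝ) : ℝ :=
  (∑ w ∈ cubeW d N, dE w a ^ 2) / ((N : ℝ) + 1) ^ d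

/-- Normalized average of squared distances from `a` to the lattice points. -/
noncomputable def B_W (d N : ℕ) (a : Fin d → ℝ) : ℝ :=
  A_W d N a / (d * (N : ℝ) ^ 2)

open Classical in
/-- Number of elements of a finite set satisfying a predicate. -/
noncomputable def pcount {α : Type*} (s : Finset α) (p : α → Prop) : ℕ :=
  (s.filter p).card

open Classical in
/-- Ordered pairs of vertices forming a non-degenerate triangle with `a`. -/
noncomputable def TaV (d N : ℕ) (a : Fin d → ℝ) : Finset ((Fin d → ℝ) × (Fin d → ℝ)) :=
  ((cubeV d N) ×ˢ (cubeV d N)).filter (fun p => a ≠ p.1 ∧ a ≠ p.2 ∧ p.1 ≠ p.2)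

open Classical in
/-- Ordered pairs of lattice points forming a non-degenerate triangle with `a`. -/
noncomputable def TaW (d N : ℕ) (a : Fin d → ℝ) : Finset ((Fin d → ℝ) × (Fin d → ℝ)) :=
  ((cubeW d N) ×ˢ (cubeW d N)).filter (fun p => a ≠ p.1 ∧ a ≠ p.2 ∧ p.1 ≠ p.2)

/-- Cosine of the angle at `c` in the triangle `(a, c, v)`. -/
noncomputable def cosAngleAt {d : ℕ} (c a v : Fin d → ℝ) : ℝ :=
  (∑ i, (a i - c i) * (v i - c i)) / (dE a c * dE v c)

theorem sum_bool_cube_succ {d : ℕ} (F : (Fin (d + 1) → Bool) → ℝ) :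
    ∑ f, F f = ∑ g : Fin d → Bool, (F (Fin.cons true g) + F (Fin.cons false g)) := by
  rw [← (Fin.consEquiv (fun _ : Fin (d + 1) => Bool)).sum_comp, Fintype.sum_prod_type]
  simp [Fin.consEquiv, Finset.sum_add_distrib]

/-- First moment of a shifted Rademacher sum. -/
theorem sum_rademacher (d : ℕ) (c : ℝ) (e : Fin d → ℝ) :
    ∑ f : Fin d → Bool, (c + ∑ i, if f i then e i else -e i) = 2 ^ d * c := by
  induction d generalizing c with
  | zero => simp
  | succ d ih =>
    rw [sum_bool_cube_succ, Finset.sum_add_distrib]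
    simp only [Fin.sum_univ_succ, Fin.cons_zero, Fin.cons_succ, ← add_assoc, if_true,
      Bool.false_eq_true, if_false]
    rw [ih (c + e 0) fun i => e i.succ, ih (c + -e 0) fun i => e i.succ]
    ring

/-- Second moment of a shifted Rademacher sum. -/
theorem sum_rademacher_sq (d : ℕ) (c : ℝ) (e : Fin d → ℝ) :
    ∑ f : Fin d → Bool, (c + ∑ i, if f i then e i else -e i) ^ 2 =
      2 ^ d * (c ^ 2 + ∑ i, e i ^ 2) := by
  induction d generalizing c with
  | zero => simp
  | succ d ih =>
    rw [sum_bool_cube_succ, Finset.sum_add_distrib]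
    simp only [Fin.sum_univ_succ, Fin.cons_zero, Fin.cons_succ, ← add_assoc, if_true,
      Bool.false_eq_true, if_false]
    rw [ih (c + e 0) fun i => e i.succ, ih (c + -e 0) fun i => e i.succ]
    ring

/-- The vertex of `{0, N}^d` selected by a Boolean vector. -/
noncomputable def cubeVertex (d N : ℕ) (f : Fin d → Bool) : Fin d → ℝ :=
  fun i => if f i then (N : ℝ) else 0

theorem cubeVertex_injective (d : ℕ) {N : ℕ} (hN : 1 ≤ N) :
    Function.Injective (cubeVertex d N) := by
  have h0 : (N : ℝ) ≠ 0 := by positivity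
  intro f g h
  funext i
  have hi := congrFun h i
  simp only [cubeVertex] at hi
  cases hf : f i <;> cases hg : g i <;> simp [hf, hg, h0, h0.symm] at hi ⊢

theorem cubeV_eq_image (d N : ℕ) : cubeV d N = Finset.univ.image (cubeVertex d N) := rfl

theorem card_cubeV (d : ℕ) {N : ℕ} (hN : 1 ≤ N) : (cubeV d N).card = 2 ^ d := by
  rw [cubeV_eq_image, Finset.card_image_of_injective _ (cubeVertex_injective d hN)]
  simp

theorem sum_cubeV (d : ℕ) {N : ℕ} (hN : 1 ≤ N) (F : (Fin d → ℝ) → ℝ) :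
    ∑ v ∈ cubeV d N, F v = ∑ f, F (cubeVertex d N f) := by
  rw [cubeV_eq_image, Finset.sum_image (cubeVertex_injective d hN).injOn]

theorem dE_sq {d : ℕ} (x y : Fin d → ℝ) : dE x y ^ 2 = ∑ i, (x i - y i) ^ 2 :=
  Real.sq_sqrt (Finset.sum_nonneg fun _ _ => sq_nonneg _)

theorem dE_comm {d : ℕ} (x y : Fin d → ℝ) : dE x y = dE y x := by
  simp only [dE, sub_sq_comm]

theorem dE_cubeVertex_sq (d N : ℕ) (a : Fin d → ℝ) (f : Fin d → Bool) :
    dE a (cubeVertex d N f) ^ 2 = ∑ i, ((a i - N) ^ 2 + a i ^ 2) / 2 +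
      ∑ i, if f i then ((a i - N) ^ 2 - a i ^ 2) / 2 else -(((a i - N) ^ 2 - a i ^ 2) / 2) := by
  rw [dE_sq, ← Finset.sum_add_distrib]
  refine Finset.sum_congr rfl fun i _ => ?_
  cases hf : f i <;> simp [cubeVertex, hf] <;> ring

theorem A_V_eq (d : ℕ) {N : ℕ} (hN : 1 ≤ N) (a : Fin d → ℝ) :
    A_V d N a = ∑ i, ((a i - N) ^ 2 + a i ^ 2) / 2 := by
  rw [A_V, sum_cubeV d hN]
  simp only [dE_comm _ a, dE_cubeVertex_sq]
  rw [sum_rademacher]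
  field_simp

theorem sum_dE_sq_sub_A_V_sq_le (d : ℕ) {N : ℕ} (hN : 1 ≤ N) (a : Fin d → ℝ)
    (ha : ∀ i, a i ∈ Set.Icc (0 : ℝ) N) :
    ∑ v ∈ cubeV d N, (dE a v ^ 2 - A_V d N a) ^ 2 ≤ 2 ^ d * (d * (N : ℝ) ^ 4 / 4) := by
  rw [sum_cubeV d hN]
  simp only [dE_cubeVertex_sq, A_V_eq d hN, add_sub_cancel_left]
  have h := sum_rademacher_sq d 0 fun i => ((a i - N) ^ 2 - a i ^ 2) / 2
  simp only [zero_add, ne_eq, OfNat.ofNat_ne_zero, not_false_eq_true, zero_pow] at h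
  rw [h]
  gcongr
  calc ∑ i, (((a i - N) ^ 2 - a i ^ 2) / 2) ^ 2 ≤ ∑ _i : Fin d, (N : ℝ) ^ 4 / 4 := by
        refine Finset.sum_le_sum fun i _ => ?_
        obtain ⟨h0, h1⟩ := ha i
        nlinarith [mul_nonneg (sq_nonneg (N : ℝ)) (mul_nonneg h0 (sub_nonneg.2 h1))]
    _ = d * (N : ℝ) ^ 4 / 4 := by simp; ring

theorem dn_sq_sub_B_V (d N : ℕ) (a v : Fin d → ℝ) :
    dn d N a v ^ 2 - B_V d N a = (dE a v ^ 2 - A_V d N a) / (d * (N : ℝ) ^ 2) := by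
  rw [dn, B_V, div_pow, mul_pow, Real.sq_sqrt (Nat.cast_nonneg d), sub_div]

/-- Chebyshev's inequality for counting in a finite set. -/
theorem pcount_mul_sq_le_sum {α : Type*} (s : Finset α) (g : α → ℝ) {t : ℝ} (ht : 0 ≤ t) :
    (pcount s (fun v => t ≤ |g v|) : ℝ) * t ^ 2 ≤ ∑ v ∈ s, g v ^ 2 := by
  classical
  rw [pcount, ← nsmul_eq_mul]
  refine (Finset.card_nsmul_le_sum _ (fun v => g v ^ 2) _ fun v hv => ?_).trans
    (Finset.sum_le_sum_of_subset_of_nonneg (Finset.filter_subset _ _) fun _ _ _ => sq_nonneg _)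
  rw [← sq_abs (g v)]
  exact pow_le_pow_left₀ ht (Finset.mem_filter.1 hv).2 2

theorem stmt17 (d N : ℕ) (hd : 1 ≤ d) (hN : 1 ≤ N) (a : Fin d → ℝ)
    (ha : ∀ i, a i ∈ Set.Icc (0 : ℝ) N) (b T : ℝ) (hb : 0 < b) (hT : 0 < T) :
    (pcount (cubeV d N) (fun v => 1 / (b * T) ≤ |dn d N a v ^ 2 - B_V d N a|) : ℝ) /
        (cubeV d N).card ≤
      b ^ 2 * T ^ 2 / (4 * (d : ℝ)) := by
  have hd' : (0 : ℝ) < d := by exact_mod_cast hd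
  have hN' : (0 : ℝ) < N := by exact_mod_cast hN
  have h := pcount_mul_sq_le_sum (cubeV d N) (fun v => dn d N a v ^ 2 - B_V d N a)
    (t := 1 / (b * T)) (by positivity)
  have h₂ : ∑ v ∈ cubeV d N, (dn d N a v ^ 2 - B_V d N a) ^ 2 ≤ 2 ^ d * (1 / (4 * d)) := by
    simp only [dn_sq_sub_B_V, div_pow, ← Finset.sum_div]
    rw [div_le_iff₀ (by positivity)]
    refine (sum_dE_sq_sub_A_V_sq_le d hN a ha).trans_eq ?_
    field_simp
  rw [card_cubeV d hN, Nat.cast_pow, Nat.cast_ofNat, div_le_iff₀ (by positivity)]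
  replace h := h.trans h₂
  rw [div_pow, one_pow, mul_one_div, div_le_iff₀ (by positivity)] at h
  refine h.trans_eq ?_
  ring
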